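/- Let φ be a convex φ-function, f ∈ L^φ(ℝ), χ ∈ L¹(ℝ) a bounded kernel with ∫_ℝ χ(z−t) dt = 1 for all z, sup_z ∫ |χ(z−t)| dt = M < ∞, ∫_{|z−t|≥γ} |χ(z−t)| dt → 0 uniformly in z for each γ > 0 (after scaling), and for every ε, γ > 0 there is R with ∫_{|z|≥R} w|χ_w(z − t/w)| dz < ε for large w and |t/w| ≤ γ, where χ_w(u) = χ(w u). Then there exists λ > 0 such that ∫_ℝ φ( λ |S_w f(z) − f(z)| ) dz → 0 as w → ∞, where S_w f(z) = ∫_ℝ χ(wz − t) ( (w/2) ∫_{(t−1)/w}^{(t+1)/w} f(u) du ) dt. -/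

import Mathlib

open MeasureTheory Filter

/-- Translation is continuous in `L¹(ℝ)`. -/
theorem tendsto_lintegral_enorm_translate_sub {g : ℝ → ℝ} (hg : Integrable g) :
    Tendsto (fun h : ℝ => ∫⁻ z, ‖g (z - h) - g z‖ₑ) (nhds 0) (nhds 0) := by
  have hmem : MemLp g 1 volume := memLp_one_iff_integrable.2 hg
  let T : C(ℝ, C(ℝ, ℝ)) :=
    (ContinuousMap.mk (fun p : ℝ × ℝ => p.2 - p.1) (by fun_prop)).curry
  have hT : ∀ h, MeasurePreserving (T h) volume volume := fun h => measurePreserving_sub_right _ h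
  have hcont := (continuous_const (y := hmem.toLp g)).compMeasurePreservingLp T.continuous hT
    ENNReal.one_ne_top
  have h0 := (tendsto_iff_edist_tendsto_0.1 (hcont.tendsto 0))
  refine h0.congr fun h => ?_
  rw [Lp.toLp_compMeasurePreserving, Lp.toLp_compMeasurePreserving, Lp.edist_toLp_toLp,
    eLpNorm_one_eq_lintegral_enorm]
  refine lintegral_congr fun z => ?_
  simp [T]

theorem ConvexOn.apply_mul_le {φ : ℝ → ℝ} (hφ : ConvexOn ℝ (Set.Ici 0) φ) (hφ0 : φ 0 = 0)
    {a u : ℝ} (ha0 : 0 ≤ a) (ha1 : a ≤ 1) (hu : 0 ≤ u) : φ (a * u) ≤ a * φ u := by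
  have := hφ.2 (Set.mem_Ici.2 hu) (Set.self_mem_Ici) ha0 (sub_nonneg.2 ha1) (by ring)
  simpa [hφ0] using this

theorem MonotoneOn.ofReal_apply_mul_abs_sub_le {φ : ℝ → ℝ} (hφ : MonotoneOn φ (Set.Ici 0))
    {c l : ℝ} (hc : 0 ≤ c) (hcl : 2 * c ≤ l) (x y : ℝ) :
    ENNReal.ofReal (φ (c * |x - y|)) ≤
      ENNReal.ofReal (φ (l * |x|)) + ENNReal.ofReal (φ (l * |y|)) := by
  have hxy : c * |x - y| ≤ c * (|x| + |y|) := mul_le_mul_of_nonneg_left (abs_sub x y) hc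
  have hl : 0 ≤ l := by linarith
  have h0 : 0 ≤ c * |x - y| := by positivity
  rcases le_total |x| |y| with h | h
  · refine le_add_left (ENNReal.ofReal_le_ofReal (hφ h0 ?_ ?_))
    · exact Set.mem_Ici.2 (by positivity)
    · nlinarith [abs_nonneg y]
  · refine le_add_right (ENNReal.ofReal_le_ofReal (hφ h0 ?_ ?_))
    · exact Set.mem_Ici.2 (by positivity)
    · nlinarith [abs_nonneg x]

theorem MonotoneOn.ofReal_apply_mul_abs_add_add_le {φ : ℝ → ℝ} (hφ : MonotoneOn φ (Set.Ici 0))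
    {l : ℝ} (hl : 0 ≤ l) (x y z : ℝ) :
    ENNReal.ofReal (φ (l / 3 * |x + y + z|)) ≤
      ENNReal.ofReal (φ (l * |x|)) + ENNReal.ofReal (φ (l * |y|)) +
        ENNReal.ofReal (φ (l * |z|)) := by
  have hxyz : |x + y + z| ≤ |x| + |y| + |z| := abs_add_three x y z
  have h0 : 0 ≤ l / 3 * |x + y + z| := by positivity
  have key : ∀ t : ℝ, |x + y + z| ≤ 3 * |t| →
      ENNReal.ofReal (φ (l / 3 * |x + y + z|)) ≤ ENNReal.ofReal (φ (l * |t|)) := fun t ht =>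
    ENNReal.ofReal_le_ofReal (hφ h0 (Set.mem_Ici.2 (by positivity)) (by nlinarith))
  by_cases hx : |x + y + z| ≤ 3 * |x|
  · exact le_add_right (le_add_right (key x hx))
  by_cases hy : |x + y + z| ≤ 3 * |y|
  · exact le_add_right (le_add_left (key y hy))
  · exact le_add_left (key z (by push Not at hx hy; linarith))

/-- A function of finite modular is approximated, in modular, by bounded integrable functions. -/
theorem exists_bounded_integrable_modular_sub_lt {φ f : ℝ → ℝ} (hφ0 : φ 0 = 0)
    (hφ_mono : MonotoneOn φ (Set.Ici 0)) (hφ_cont : Continuous φ) (hf : Measurable f)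
    {l : ℝ} (hl : 0 < l) (hfin : ∫⁻ z : ℝ, ENNReal.ofReal (φ (l * |f z|)) < ⊤)
    {ε : ENNReal} (hε : 0 < ε) :
    ∃ (B : ℝ) (g : ℝ → ℝ), 0 < B ∧ Measurable g ∧ Integrable g ∧ (∀ z, |g z| ≤ B) ∧
      ∫⁻ z : ℝ, ENNReal.ofReal (φ (l * |f z - g z|)) < ε := by
  let s : ℕ → Set ℝ := fun n => {z | |z| ≤ n ∧ |f z| ≤ n}
  have hs : ∀ n, MeasurableSet (s n) := fun n =>
    (measurableSet_le measurable_norm measurable_const).inter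
      (measurableSet_le hf.norm measurable_const)
  have hlim : Tendsto (fun n : ℕ => ∫⁻ z : ℝ, ENNReal.ofReal (φ (l * |f z - (s n).indicator f z|)))
      atTop (nhds (∫⁻ _ : ℝ, 0)) := by
    refine tendsto_lintegral_of_dominated_convergence
      (fun z => ENNReal.ofReal (φ (l * |f z|))) (fun n => ?_) (fun n => .of_forall fun z => ?_)
      hfin.ne (.of_forall fun z => ?_)
    · have := hf.indicator (hs n)
      fun_prop
    · refine ENNReal.ofReal_le_ofReal (hφ_mono ?_ ?_ ?_)
      · exact Set.mem_Ici.2 (by positivity)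
      · exact Set.mem_Ici.2 (by positivity)
      · by_cases hz : z ∈ s n
        · simp [hz]; positivity
        · simp [hz]
    · refine tendsto_const_nhds.congr' ?_
      filter_upwards [eventually_ge_atTop ⌈max |z| |f z|⌉₊] with n hn
      have hz : z ∈ s n := by
        have := Nat.ceil_le.1 hn
        exact ⟨(le_max_left _ _).trans this, (le_max_right _ _).trans this⟩
      simp [hz, hφ0]
  rw [lintegral_zero] at hlim
  obtain ⟨n, hn, hn1⟩ := ((hlim.eventually (gt_mem_nhds hε)).and (eventually_ge_atTop 1)).exists
  have hb : ∀ z, |(s n).indicator f z| ≤ n := fun z => by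
    by_cases hz : z ∈ s n
    · simpa [hz] using hz.2
    · simp [hz]
  refine ⟨n, (s n).indicator f, by exact_mod_cast hn1, hf.indicator (hs n), ?_, hb, hn⟩
  rw [integrable_indicator_iff (hs n)]
  refine IntegrableOn.of_bound ?_ hf.aestronglyMeasurable n ?_
  · refine (measure_mono (t := Set.Icc (-(n : ℝ)) n) fun z hz => abs_le.1 hz.1).trans_lt ?_
    simp
  · exact (ae_restrict_mem (hs n)).mono fun z hz => hz.2

/-- Translation is continuous in modular. -/
theorem tendsto_modular_translate_sub {φ f : ℝ → ℝ} (hφ_conv : ConvexOn ℝ (Set.Ici 0) φ)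
    (hφ0 : φ 0 = 0) (hφ_mono : MonotoneOn φ (Set.Ici 0)) (hφ_cont : Continuous φ)
    (hf : Measurable f) {l : ℝ} (hl : 0 < l)
    (hfin : ∫⁻ z : ℝ, ENNReal.ofReal (φ (l * |f z|)) < ⊤) :
    Tendsto (fun h : ℝ => ∫⁻ z : ℝ, ENNReal.ofReal (φ (l / 3 * |f (z - h) - f z|)))
      (nhds 0) (nhds 0) := by
  rw [ENNReal.tendsto_nhds_zero]
  intro ε hε
  have hε3 : 0 < ε / 3 := ENNReal.div_pos hε.ne' (by simp)
  obtain ⟨B, g, hB, hgm, hgi, hgB, hr⟩ :=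
    exists_bounded_integrable_modular_sub_lt hφ0 hφ_mono hφ_cont hf hl hfin hε3
  let C : ENNReal := ENNReal.ofReal (φ (l * (2 * B)) / (2 * B))
  have hgt : Tendsto (fun h : ℝ => C * ∫⁻ z, ‖g (z - h) - g z‖ₑ) (nhds 0) (nhds 0) := by
    simpa using ENNReal.Tendsto.const_mul (a := C) (tendsto_lintegral_enorm_translate_sub hgi)
      (Or.inr ENNReal.ofReal_ne_top)
  filter_upwards [hgt.eventually (gt_mem_nhds hε3)] with h hh
  have hgφ : ∀ z, ENNReal.ofReal (φ (l * |g (z - h) - g z|)) ≤ C * ‖g (z - h) - g z‖ₑ := by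
    intro z
    rw [Real.enorm_eq_ofReal_abs, ← ENNReal.ofReal_mul']
    · refine ENNReal.ofReal_le_ofReal ?_
      have hΔ : |g (z - h) - g z| ≤ 2 * B := by
        linarith [abs_sub (g (z - h)) (g z), hgB (z - h), hgB z]
      have := hφ_conv.apply_mul_le hφ0 (a := |g (z - h) - g z| / (2 * B)) (u := l * (2 * B))
        (by positivity) ((div_le_one (by positivity)).2 hΔ) (by positivity)
      calc φ (l * |g (z - h) - g z|)
          = φ (|g (z - h) - g z| / (2 * B) * (l * (2 * B))) := by congr 1; field_simp
        _ ≤ _ := this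
        _ = _ := by ring
    · exact abs_nonneg _
  have hm : Measurable fun z => ENNReal.ofReal (φ (l * |f z - g z|)) := by fun_prop
  calc ∫⁻ z : ℝ, ENNReal.ofReal (φ (l / 3 * |f (z - h) - f z|))
      ≤ ∫⁻ z : ℝ, (ENNReal.ofReal (φ (l * |f (z - h) - g (z - h)|)) +
          C * ‖g (z - h) - g z‖ₑ + ENNReal.ofReal (φ (l * |f z - g z|))) := by
        refine lintegral_mono fun z => ?_
        have h3 := hφ_mono.ofReal_apply_mul_abs_add_add_le hl.le (f (z - h) - g (z - h))
          (g (z - h) - g z) (g z - f z)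
        rw [abs_sub_comm (g z) (f z)] at h3
        rw [show f (z - h) - g (z - h) + (g (z - h) - g z) + (g z - f z) = f (z - h) - f z by ring]
          at h3
        exact h3.trans (by gcongr; exact hgφ z)
    _ = (∫⁻ z : ℝ, ENNReal.ofReal (φ (l * |f z - g z|))) +
          C * (∫⁻ z, ‖g (z - h) - g z‖ₑ) + ∫⁻ z : ℝ, ENNReal.ofReal (φ (l * |f z - g z|)) := by
        rw [lintegral_add_right _ hm, lintegral_add_right _ (by fun_prop),
          lintegral_const_mul _ (by fun_prop),
          lintegral_sub_right_eq_self (fun z => ENNReal.ofReal (φ (l * |f z - g z|))) h]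
    _ ≤ ε / 3 + ε / 3 + ε / 3 := by gcongr
    _ = ε := ENNReal.add_thirds ε

/-- Jensen's inequality in `ℝ≥0∞`, without integrability of the composition. -/
theorem ConvexOn.ofReal_map_integral_le {X : Type*} [MeasurableSpace X] {ν : Measure X}
    [IsProbabilityMeasure ν] {φ : ℝ → ℝ} (hφ_conv : ConvexOn ℝ (Set.Ici 0) φ)
    (hφ_nonneg : ∀ u ≥ 0, 0 ≤ φ u) (hφ_cont : Continuous φ) {g : X → ℝ} (hg : Integrable g ν)
    (hg0 : ∀ x, 0 ≤ g x) :
    ENNReal.ofReal (φ (∫ x, g x ∂ν)) ≤ ∫⁻ x, ENNReal.ofReal (φ (g x)) ∂ν := by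
  by_cases hi : Integrable (φ ∘ g) ν
  · have hint := ofReal_integral_eq_lintegral_ofReal hi (.of_forall fun x => hφ_nonneg _ (hg0 x))
    simp only [Function.comp_apply] at hint
    rw [← hint]
    exact ENNReal.ofReal_le_ofReal
      (hφ_conv.map_integral_le hφ_cont.continuousOn isClosed_Ici (.of_forall hg0) hg hi)
  · have htop : ∫⁻ x, ENNReal.ofReal (φ (g x)) ∂ν = ⊤ := by
      by_contra hne
      exact hi ((lintegral_ofReal_ne_top_iff_integrable
        (hφ_cont.comp_aestronglyMeasurable hg.1)
        (.of_forall fun x => hφ_nonneg _ (hg0 x))).1 hne)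
    rw [htop]
    exact le_top

/-- If `f` has finite modular, then `x ↦ f (z - T x)` is integrable for almost every `z`. -/
theorem ae_integrable_translate {X : Type*} [MeasurableSpace X] {ν : Measure X}
    [IsFiniteMeasure ν] {φ f : ℝ → ℝ} (hφ_conv : ConvexOn ℝ (Set.Ici 0) φ)
    (hφ0 : φ 0 = 0) (hφ_pos : ∀ u > (0 : ℝ), 0 < φ u) (hφ_cont : Continuous φ)
    (hf : Measurable f) {l : ℝ} (hl : 0 < l)
    (hfin : ∫⁻ z : ℝ, ENNReal.ofReal (φ (l * |f z|)) < ⊤) {T : X → ℝ} (hT : Measurable T) :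
    ∀ᵐ z : ℝ, Integrable (fun x => f (z - T x)) ν := by
  have hmeas : Measurable fun p : ℝ × X => ENNReal.ofReal (φ (l * |f (p.1 - T p.2)|)) := by
    fun_prop
  have hswap : ∫⁻ z : ℝ, ∫⁻ x, ENNReal.ofReal (φ (l * |f (z - T x)|)) ∂ν < ⊤ := by
    rw [lintegral_lintegral_swap hmeas.aemeasurable]
    have : ∀ x, ∫⁻ z : ℝ, ENNReal.ofReal (φ (l * |f (z - T x)|)) =
        ∫⁻ z : ℝ, ENNReal.ofReal (φ (l * |f z|)) := fun x =>
      lintegral_sub_right_eq_self (fun z => ENNReal.ofReal (φ (l * |f z|))) (T x)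
    simp_rw [this, lintegral_const]
    exact ENNReal.mul_lt_top hfin (measure_lt_top _ _)
  have hnonneg : ∀ u : ℝ, 0 ≤ u → 0 ≤ φ u := fun u hu =>
    hu.eq_or_lt.elim (fun h => by rw [← h, hφ0]) fun h => (hφ_pos u h).le
  filter_upwards [ae_lt_top hmeas.lintegral_prod_right' hswap.ne] with z hz
  have hi : Integrable (fun x => φ (l * |f (z - T x)|)) ν :=
    (lintegral_ofReal_ne_top_iff_integrable
      (Measurable.aestronglyMeasurable (by fun_prop))
      (.of_forall fun x => hnonneg _ (by positivity))).1 hz.ne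
  refine ((integrable_const (1 : ℝ)).add (hi.div_const (φ l))).mono'
    (Measurable.aestronglyMeasurable (by fun_prop)) (.of_forall fun x => ?_)
  set u := |f (z - T x)| with hu
  have hφl := hφ_pos l hl
  have hφu := hnonneg (l * u) (by positivity)
  rw [Real.norm_eq_abs, ← hu, Pi.add_apply]
  rcases le_total u 1 with h | h
  · have : 0 ≤ φ (l * u) / φ l := by positivity
    linarith
  · have h1 := hφ_conv.apply_mul_le hφ0 (a := u⁻¹) (u := l * u) (by positivity)
      (inv_le_one_of_one_le₀ h) (by positivity)
    have hu0 : u ≠ 0 := by positivity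
    rw [show u⁻¹ * (l * u) = l by field_simp] at h1
    have : u ≤ φ (l * u) / φ l := by
      rw [le_div_iff₀ hφl]
      calc u * φ l ≤ u * (u⁻¹ * φ (l * u)) := by gcongr
        _ = φ (l * u) := by field_simp
    linarith

/-- The weight `|χ|` on `ℝ × [-1, 1]`, normalised to mass one. -/
noncomputable def kantorovichMeasure (χ : ℝ → ℝ) : Measure (ℝ × ℝ) :=
  (volume.prod (volume.restrict (Set.Icc (-1) 1))).withDensity
    fun p => ENNReal.ofReal (|χ p.1| / (2 * ∫ s, |χ s|))

theorem isProbabilityMeasure_kantorovichMeasure {χ : ℝ → ℝ} (hχ : Integrable χ)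
    (hM : 0 < ∫ s, |χ s|) : IsProbabilityMeasure (kantorovichMeasure χ) := by
  have hi : Integrable (fun p : ℝ × ℝ => |χ p.1| / (2 * ∫ s, |χ s|))
      (volume.prod (volume.restrict (Set.Icc (-1) 1))) :=
    (hχ.abs.comp_fst _).div_const _
  refine ⟨?_⟩
  rw [kantorovichMeasure, withDensity_apply _ MeasurableSet.univ, Measure.restrict_univ,
    ← ofReal_integral_eq_lintegral_ofReal hi (.of_forall fun p => by positivity),
    integral_div, integral_fun_fst (fun s => |χ s|)]
  simp only [measureReal_restrict_apply_univ, Real.volume_real_Icc, smul_eq_mul]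
  norm_num
  exact hM.ne'

theorem integral_kantorovichMeasure {χ : ℝ → ℝ} (hχ : Integrable χ) (g : ℝ × ℝ → ℝ) :
    ∫ p, g p ∂kantorovichMeasure χ =
      ∫ p, |χ p.1| / (2 * ∫ s, |χ s|) * g p
        ∂volume.prod (volume.restrict (Set.Icc (-1 : ℝ) 1)) := by
  have hm : AEMeasurable (fun p : ℝ × ℝ => ENNReal.ofReal (|χ p.1| / (2 * ∫ s, |χ s|)))
      (volume.prod (volume.restrict (Set.Icc (-1) 1))) :=
    ((hχ.abs.comp_fst _).div_const _).aestronglyMeasurable.aemeasurable.ennreal_ofReal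
  rw [kantorovichMeasure, integral_withDensity_eq_integral_toReal_smul₀ hm
    (.of_forall fun _ => ENNReal.ofReal_lt_top)]
  refine integral_congr_ae (.of_forall fun p => ?_)
  have h0 : 0 ≤ |χ p.1| / (2 * ∫ s, |χ s|) :=
    div_nonneg (abs_nonneg _) (mul_nonneg zero_le_two (integral_nonneg fun _ => abs_nonneg _))
  simp only [ENNReal.toReal_ofReal h0, smul_eq_mul]

theorem integrable_of_integrable_kantorovichMeasure {χ : ℝ → ℝ} (hχ : Integrable χ)
    (hM : 0 < ∫ s, |χ s|) {g : ℝ × ℝ → ℝ} (hg : Measurable g)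
    (hi : Integrable g (kantorovichMeasure χ)) :
    Integrable (fun p => χ p.1 * g p) (volume.prod (volume.restrict (Set.Icc (-1 : ℝ) 1))) := by
  have hχf := hχ.comp_fst (volume.restrict (Set.Icc (-1 : ℝ) 1))
  have hm : AEMeasurable (fun p : ℝ × ℝ => ENNReal.ofReal (|χ p.1| / (2 * ∫ s, |χ s|)))
      (volume.prod (volume.restrict (Set.Icc (-1) 1))) :=
    (hχf.abs.div_const _).aestronglyMeasurable.aemeasurable.ennreal_ofReal
  rw [kantorovichMeasure, integrable_withDensity_iff_integrable_smul₀' hm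
    (.of_forall fun _ => ENNReal.ofReal_lt_top)] at hi
  refine (hi.norm.const_mul (2 * ∫ s, |χ s|)).mono'
    (hχf.aestronglyMeasurable.mul hg.aestronglyMeasurable) (.of_forall fun p => ?_)
  have h0 : 0 ≤ |χ p.1| / (2 * ∫ s, |χ s|) := by positivity
  rw [ENNReal.toReal_ofReal h0, norm_smul, norm_mul, Real.norm_of_nonneg h0, Real.norm_eq_abs]
  refine le_of_eq ?_
  field_simp

/-- The Kantorovich operator as an average of translates of `f`. -/
theorem integral_mul_average_eq_integral_prod {χ f : ℝ → ℝ} {w z : ℝ} (hw : 0 < w)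
    (hi : Integrable (fun p : ℝ × ℝ => χ p.1 * f (z - (p.1 + p.2) / w))
      (volume.prod (volume.restrict (Set.Icc (-1) 1)))) :
    ∫ t, χ (w * z - t) * ((w / 2) * ∫ u in Set.Icc ((t - 1) / w) ((t + 1) / w), f u) =
      (1 / 2) * ∫ p : ℝ × ℝ, χ p.1 * f (z - (p.1 + p.2) / w)
        ∂volume.prod (volume.restrict (Set.Icc (-1) 1)) := by
  rw [integral_prod _ hi, ← integral_const_mul,
    ← integral_sub_left_eq_self _ volume (w * z)]
  refine integral_congr_ae (.of_forall fun s => ?_)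
  simp only [sub_sub_cancel]
  rw [integral_const_mul, integral_Icc_eq_integral_Ioc, integral_Icc_eq_integral_Ioc,
    ← intervalIntegral.integral_of_le (by gcongr; linarith),
    ← intervalIntegral.integral_of_le (by norm_num)]
  have h := intervalIntegral.integral_comp_sub_div (a := -1) (b := 1) f hw.ne' (z - s / w)
  have hl : ∀ r : ℝ, z - (s + r) / w = z - s / w - r / w := fun r => by ring
  simp_rw [hl]
  rw [h, smul_eq_mul, show (w * z - s - 1) / w = z - s / w - 1 / w by field_simp,
    show (w * z - s + 1) / w = z - s / w - -1 / w by field_simp; ring]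
  ring

theorem abs_kantorovich_sub_le {χ f : ℝ → ℝ} (hχ : Integrable χ) (hχ1 : ∫ s, χ s = 1)
    (hM : 0 < ∫ s, |χ s|) (hf : Measurable f) {w z : ℝ} (hw : 0 < w)
    (hi : Integrable (fun p : ℝ × ℝ => f (z - (p.1 + p.2) / w)) (kantorovichMeasure χ)) :
    |(∫ t, χ (w * z - t) * ((w / 2) * ∫ u in Set.Icc ((t - 1) / w) ((t + 1) / w), f u)) - f z| ≤
      (∫ s, |χ s|) *
        ∫ p : ℝ × ℝ, |f (z - (p.1 + p.2) / w) - f z| ∂kantorovichMeasure χ := by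
  have hi' := integrable_of_integrable_kantorovichMeasure hχ hM (by fun_prop) hi
  have hc : Integrable (fun p : ℝ × ℝ => χ p.1 * f z)
      (volume.prod (volume.restrict (Set.Icc (-1) 1))) := (hχ.comp_fst _).mul_const _
  have hfz : f z = (1 / 2) * ∫ p : ℝ × ℝ, χ p.1 * f z
      ∂volume.prod (volume.restrict (Set.Icc (-1 : ℝ) 1)) := by
    rw [integral_mul_const, integral_fun_fst χ, hχ1]
    simp only [measureReal_restrict_apply_univ, Real.volume_real_Icc, smul_eq_mul]
    norm_num
    ring
  rw [integral_mul_average_eq_integral_prod hw hi']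
  calc _ = |(1 / 2) * ∫ p : ℝ × ℝ, (χ p.1 * f (z - (p.1 + p.2) / w) - χ p.1 * f z)
        ∂volume.prod (volume.restrict (Set.Icc (-1 : ℝ) 1))| := by
        rw [integral_sub hi' hc, mul_sub, ← hfz]
    _ ≤ (1 / 2) * ∫ p : ℝ × ℝ, |χ p.1 * f (z - (p.1 + p.2) / w) - χ p.1 * f z|
        ∂volume.prod (volume.restrict (Set.Icc (-1 : ℝ) 1)) := by
        rw [abs_mul, abs_of_pos one_half_pos]
        gcongr
        exact abs_integral_le_integral_abs
    _ = _ := by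
        rw [integral_kantorovichMeasure hχ, ← integral_const_mul, ← integral_const_mul]
        refine integral_congr_ae (.of_forall fun p => ?_)
        simp only [← mul_sub, abs_mul]
        field_simp

/-- modular convergence of the Kantorovich convolution-type
operators `S_w f(z) = ∫ χ(wz - t) ((w/2)∫_{(t-1)/w}^{(t+1)/w} f) dt` for
`f ∈ L^φ(ℝ)`: there is `λ > 0` with `∫ φ(λ|S_w f - f|) → 0`. -/
theorem kantorovich_convolution_modular_convergence
    (φ : ℝ → ℝ) (χ f : ℝ → ℝ)
    (hφ_conv : ConvexOn ℝ (Set.Ici 0) φ)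
    (hφ0 : φ 0 = 0) (hφ_pos : ∀ u > (0:ℝ), 0 < φ u)
    (hφ_mono : MonotoneOn φ (Set.Ici 0)) (hφ_cont : Continuous φ)
    (hφ_infty : Tendsto φ atTop atTop)
    (hf : Measurable f)
    (hfLφ : ∃ l > (0:ℝ), ∫⁻ z : ℝ, ENNReal.ofReal (φ (l * |f z|)) < ⊤)
    (hχ_int : Integrable χ) (hχ_bdd : ∃ K, ∀ u, |χ u| ≤ K)
    (hχ_norm : ∀ z : ℝ, ∫ t, χ (z - t) = 1)
    (hχ_abs : ∃ M : ℝ, ∀ z : ℝ, ∫ t, |χ (z - t)| ≤ M)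
    (hχ_conc : ∀ γ > (0:ℝ), ∀ ε > (0:ℝ), ∃ W : ℝ, ∀ w ≥ W, ∀ z : ℝ,
      ∫ t in {t : ℝ | γ ≤ |z - t|}, |w * χ (w * (z - t))| < ε)
    (hχ_tail : ∀ ε > (0:ℝ), ∀ γ > (0:ℝ), ∃ R > (0:ℝ), ∃ W : ℝ, ∀ w ≥ W,
      ∀ t : ℝ, |t / w| ≤ γ →
        ∫ z in {z : ℝ | R ≤ |z|}, w * |χ (w * z - t)| < ε) :
    ∃ lam > (0:ℝ),
      Tendsto (fun w : ℝ =>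
        ∫⁻ z : ℝ, ENNReal.ofReal (φ (lam *
          |(∫ t : ℝ, χ (w * z - t) *
            ((w / 2) * ∫ u in Set.Icc ((t - 1) / w) ((t + 1) / w), f u)) - f z|)))
        atTop (nhds 0) := by
  obtain ⟨l, hl, hfin⟩ := hfLφ
  have hφ_nonneg : ∀ u ≥ (0 : ℝ), 0 ≤ φ u := fun u hu =>
    hu.eq_or_lt.elim (fun h => by rw [← h, hφ0]) fun h => (hφ_pos u h).le
  have hχ1 : ∫ s, χ s = 1 := by
    rw [← hχ_norm 0, integral_sub_left_eq_self χ volume 0]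
  have hM : 0 < ∫ s, |χ s| := by
    have := (le_abs_self _).trans (abs_integral_le_integral_abs (f := χ) (μ := volume))
    linarith
  have := isProbabilityMeasure_kantorovichMeasure hχ_int hM
  set M := ∫ s, |χ s| with hM_def
  refine ⟨l / 3 / M, by positivity, ?_⟩
  let ω : ℝ → ENNReal := fun h => ∫⁻ z : ℝ, ENNReal.ofReal (φ (l / 3 * |f (z - h) - f z|))
  have hω : Tendsto ω (nhds 0) (nhds 0) :=
    tendsto_modular_translate_sub hφ_conv hφ0 hφ_mono hφ_cont hf hl hfin
  have hω_meas : Measurable ω :=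
    Measurable.lintegral_prod_right' (f := fun p : ℝ × ℝ =>
      ENNReal.ofReal (φ (l / 3 * |f (p.2 - p.1) - f p.2|))) (by fun_prop)
  have hω_le : ∀ h, ω h ≤ 2 * ∫⁻ z : ℝ, ENNReal.ofReal (φ (l * |f z|)) := fun h => by
    calc ω h ≤ ∫⁻ z : ℝ, (ENNReal.ofReal (φ (l * |f (z - h)|)) +
          ENNReal.ofReal (φ (l * |f z|))) := lintegral_mono fun z =>
            hφ_mono.ofReal_apply_mul_abs_sub_le (by positivity) (by linarith) _ _
      _ = _ := by
        rw [lintegral_add_right _ (by fun_prop),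
          lintegral_sub_right_eq_self (fun z => ENNReal.ofReal (φ (l * |f z|))) h, two_mul]
  have hlim : Tendsto (fun w : ℝ => ∫⁻ p : ℝ × ℝ, ω ((p.1 + p.2) / w) ∂kantorovichMeasure χ)
      atTop (nhds 0) := by
    have := tendsto_lintegral_filter_of_dominated_convergence (μ := kantorovichMeasure χ)
      (l := atTop) (F := fun (w : ℝ) (p : ℝ × ℝ) => ω ((p.1 + p.2) / w)) (f := fun _ => 0)
      (fun _ => 2 * ∫⁻ z : ℝ, ENNReal.ofReal (φ (l * |f z|)))
      (.of_forall fun w => hω_meas.comp (by fun_prop))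
      (.of_forall fun w => .of_forall fun p => hω_le _)
      (by simpa using ENNReal.mul_ne_top ENNReal.ofNat_ne_top hfin.ne)
      (.of_forall fun p => hω.comp (tendsto_const_nhds.div_atTop tendsto_id))
    simpa using this
  refine tendsto_of_tendsto_of_tendsto_of_le_of_le' tendsto_const_nhds hlim
    (.of_forall fun _ => zero_le) ?_
  filter_upwards [eventually_gt_atTop 0] with w hw
  have hmeas : Measurable fun q : (ℝ × ℝ) × ℝ =>
      ENNReal.ofReal (φ (l / 3 * |f (q.2 - (q.1.1 + q.1.2) / w) - f q.2|)) := by fun_prop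
  rw [lintegral_lintegral_swap hmeas.aemeasurable]
  refine lintegral_mono_ae ?_
  filter_upwards [ae_integrable_translate (ν := kantorovichMeasure χ) hφ_conv hφ0 hφ_pos hφ_cont
    hf hl hfin (T := fun p : ℝ × ℝ => (p.1 + p.2) / w) (by fun_prop)] with z hz
  have hle := abs_kantorovich_sub_le hχ_int hχ1 hM hf hw hz
  rw [← hM_def] at hle
  have hJ := hφ_conv.ofReal_map_integral_le (ν := kantorovichMeasure χ) hφ_nonneg hφ_cont
    (((hz.sub (integrable_const (f z))).abs).const_mul (l / 3)) (fun p => by positivity)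
  refine le_trans (ENNReal.ofReal_le_ofReal (hφ_mono (Set.mem_Ici.2 (by positivity)) ?_ ?_)) hJ
  · exact Set.mem_Ici.2 (integral_nonneg fun p => by positivity)
  · rw [integral_const_mul]
    calc _ ≤ l / 3 / M * (M * _) := mul_le_mul_of_nonneg_left hle (by positivity)
      _ = _ := by field_simp; rfl
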